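/- arXiv:2302.10052 — 2 statements merged into one kernel-verified Lean document; each statement's English description precedes it below -/
import Mathlib

section
/- Let G be a finite cyclic subgroup of GL_m(K) of order d consisting of scalar matrices. Then the algebra of invariants K⟨x_1,…,x_m⟩^G is spanned by the monomials whose total degree is divisible by d, and it is isomorphic as a K-algebra to the free associative algebra of rank m^d. -/
open Matrix

/-- The action of a matrix `g` on the free associative algebra `K⟨x_1,…,x_m⟩` by linear
substitution of the free generators: `x_j ↦ ∑ i, g i j • x_i`. -/
noncomputable def freeAct (K : Type*) [CommSemiring K] {m : ℕ}
    (g : Matrix (Fin m) (Fin m) K) :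
    FreeAlgebra K (Fin m) →ₐ[K] FreeAlgebra K (Fin m) :=
  FreeAlgebra.lift K fun j => ∑ i, g i j • FreeAlgebra.ι K i

/-- The subalgebra of invariants `K⟨x_1,…,x_m⟩^G` of a subgroup `G` of `GL_m(K)`. -/
noncomputable def freeInvariants (K : Type*) [Field K] {m : ℕ}
    (G : Subgroup (GL (Fin m) K)) : Subalgebra K (FreeAlgebra K (Fin m)) :=
  ⨅ g ∈ G, AlgHom.equalizer
    (freeAct K ((g : GL (Fin m) K) : Matrix (Fin m) (Fin m) K)) (AlgHom.id K _)

namespace FreeMonoid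

variable {X Y : Type*} {d : ℕ} {code : Y → FreeMonoid X}

/-- A substitution of letters by distinct words of the same positive length is injective. -/
theorem lift_injective_of_length_eq (hd : 0 < d) (hinj : Function.Injective code)
    (hlen : ∀ y, (code y).length = d) : Function.Injective (lift code) := by
  have hcons (y : Y) (u : FreeMonoid Y) : (lift code (of y * u)).length ≠ 0 := by
    rw [map_mul, lift_eval_of, length_mul, hlen]
    omega
  intro u
  induction u using FreeMonoid.inductionOn' with
  | one =>
    intro v h
    cases v using FreeMonoid.casesOn with
    | one => rfl
    | of_mul y v => exact absurd (by rw [← h, map_one, length_one]) (hcons y v)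
  | of_mul x u ih =>
    intro v h
    cases v using FreeMonoid.casesOn with
    | one => exact absurd (by rw [h, map_one, length_one]) (hcons x u)
    | of_mul y v =>
      rw [map_mul, map_mul, lift_eval_of, lift_eval_of] at h
      obtain ⟨hxy, huv⟩ := List.append_inj h ((hlen x).trans (hlen y).symm)
      rw [hinj hxy, ih huv]

/-- If the words `code y` are exactly the words of length `d`, then their products are exactly the
words whose length is divisible by `d`. -/
theorem range_lift_eq_of_range_eq (hcode : Set.range code = {w | w.length = d}) :
    Set.range (lift code) = {w | d ∣ w.length} := by
  ext w
  constructor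
  · rintro ⟨u, rfl⟩
    induction u using FreeMonoid.inductionOn' with
    | one => simp
    | of_mul y u ih =>
      have hy : (code y).length = d := hcode.subset ⟨y, rfl⟩
      simp only [Set.mem_ofPred_eq, map_mul, lift_eval_of, length_mul, hy] at ih ⊢
      exact dvd_add dvd_rfl ih
  · rintro ⟨k, hk⟩
    induction k generalizing w with
    | zero => exact ⟨1, by rw [map_one, length_eq_zero.mp (hk.trans (mul_zero d))]⟩
    | succ k ih =>
      have hk' : (toList w).length = d * (k + 1) := hk
      obtain ⟨y, hy⟩ : ofList ((toList w).take d) ∈ Set.range code := by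
        rw [hcode]
        show ((toList w).take d).length = d
        rw [List.length_take, hk']
        exact min_eq_left (Nat.le_mul_of_pos_right d k.succ_pos)
      obtain ⟨u, hu⟩ := ih (w := ofList ((toList w).drop d)) (by
        show ((toList w).drop d).length = d * k
        rw [List.length_drop, hk', mul_add, mul_one, Nat.add_sub_cancel])
      refine ⟨of y * u, ?_⟩
      rw [map_mul, lift_eval_of, hy, hu]
      exact List.take_append_drop d (toList w)

end FreeMonoid

namespace FreeAlgebra

variable {R X Y : Type*}

theorem basisFreeMonoid_apply [CommSemiring R] (w : FreeMonoid X) :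
    basisFreeMonoid R X w = FreeMonoid.lift (ι R) w := by
  simp [basisFreeMonoid, equivMonoidAlgebraFreeMonoid]

theorem lift_comp_freeMonoidLift [CommSemiring R] (code : Y → FreeMonoid X) (u : FreeMonoid Y) :
    lift R (fun y => FreeMonoid.lift (ι R) (code y)) (FreeMonoid.lift (ι R) u) =
      FreeMonoid.lift (ι R) (FreeMonoid.lift code u) := by
  induction u using FreeMonoid.inductionOn' with
  | one => simp only [map_one]
  | of_mul y u ih => simp only [map_mul, ih, FreeMonoid.lift_eval_of, lift_ι_apply]

/-- An injective substitution of words induces an injective homomorphism of free algebras. -/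
theorem lift_injective_of_freeMonoidLift_injective [CommRing R] {code : Y → FreeMonoid X}
    (h : Function.Injective (FreeMonoid.lift code)) :
    Function.Injective (lift R fun y => FreeMonoid.lift (ι R) (code y)) := by
  refine LinearMap.injective_of_linearIndependent
    (f := (lift R fun y => FreeMonoid.lift (ι R) (code y)).toLinearMap)
    (basisFreeMonoid R Y).span_eq ?_
  have hcomp : (lift R fun y => FreeMonoid.lift (ι R) (code y)).toLinearMap ∘ basisFreeMonoid R Y =
      basisFreeMonoid R X ∘ FreeMonoid.lift code := by
    funext u
    simp only [Function.comp_apply, basisFreeMonoid_apply, AlgHom.toLinearMap_apply,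
      lift_comp_freeMonoidLift]
  exact hcomp ▸ (basisFreeMonoid R X).linearIndependent.comp _ h

theorem toSubmodule_range_lift_word [CommRing R] (code : Y → FreeMonoid X) :
    Subalgebra.toSubmodule (lift R fun y => FreeMonoid.lift (ι R) (code y)).range =
      Submodule.span R (FreeMonoid.lift (ι R) '' Set.range (FreeMonoid.lift code)) := by
  change LinearMap.range (lift R fun y => FreeMonoid.lift (ι R) (code y)).toLinearMap = _
  rw [LinearMap.range_eq_map, ← (basisFreeMonoid R Y).span_eq,
    Submodule.map_span, ← Set.range_comp, ← Set.range_comp]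
  congr 2
  funext u
  simp only [Function.comp_apply, basisFreeMonoid_apply, AlgHom.toLinearMap_apply,
    lift_comp_freeMonoidLift]

end FreeAlgebra

section ScalarAction

open FreeAlgebra

variable {K : Type*} {m : ℕ}

theorem freeAct_smul_one_word [CommSemiring K] (c : K) (w : FreeMonoid (Fin m)) :
    freeAct K (c • (1 : Matrix (Fin m) (Fin m) K)) (FreeMonoid.lift (ι K) w) =
      c ^ w.length • FreeMonoid.lift (ι K) w := by
  induction w using FreeMonoid.inductionOn' with
  | one => simp
  | of_mul i w ih =>
    have hi : freeAct K (c • (1 : Matrix (Fin m) (Fin m) K)) (ι K i) = c • ι K i := by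
      simp [freeAct, Matrix.one_apply]
    rw [map_mul, map_mul, ih, FreeMonoid.lift_eval_of, hi, smul_mul_smul_comm,
      FreeMonoid.length_mul, FreeMonoid.length_of, pow_add, pow_one]

theorem repr_freeAct_smul_one [CommSemiring K] (c : K) (x : FreeAlgebra K (Fin m))
    (w : FreeMonoid (Fin m)) :
    (basisFreeMonoid K (Fin m)).repr (freeAct K (c • (1 : Matrix (Fin m) (Fin m) K)) x) w =
      c ^ w.length * (basisFreeMonoid K (Fin m)).repr x w := by
  let b := basisFreeMonoid K (Fin m)
  suffices h : Finsupp.lapply w ∘ₗ b.repr.toLinearMap ∘ₗ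
      (freeAct K (c • (1 : Matrix (Fin m) (Fin m) K))).toLinearMap =
        c ^ w.length • (Finsupp.lapply w ∘ₗ b.repr.toLinearMap) from LinearMap.congr_fun h x
  refine b.ext fun u => ?_
  have hu : freeAct K (c • (1 : Matrix (Fin m) (Fin m) K)) (b u) = c ^ u.length • b u := by
    rw [basisFreeMonoid_apply, freeAct_smul_one_word]
  obtain rfl | h := eq_or_ne u w
  · simp [hu]
  · simp [hu, h]

theorem mem_freeInvariants [Field K] {G : Subgroup (GL (Fin m) K)} {x : FreeAlgebra K (Fin m)} :
    x ∈ freeInvariants K G ↔ ∀ g ∈ G, freeAct K (g : Matrix (Fin m) (Fin m) K) x = x := by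
  simp [freeInvariants, Algebra.mem_iInf, AlgHom.mem_equalizer]

/-- A cyclic group of scalar matrices of order `d` contains a primitive `d`-th root of unity. -/
theorem exists_isPrimitiveRoot_of_scalar [Field K] (G : Subgroup (GL (Fin m) K)) [IsCyclic G]
    (hscalar : ∀ g : GL (Fin m) K, g ∈ G → ∃ c : K,
      (g : Matrix (Fin m) (Fin m) K) = c • (1 : Matrix (Fin m) (Fin m) K)) :
    ∃ c : K, IsPrimitiveRoot c (Nat.card G) ∧
      ∃ g ∈ G, (g : Matrix (Fin m) (Fin m) K) = c • (1 : Matrix (Fin m) (Fin m) K) := by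
  rcases isEmpty_or_nonempty (Fin m) with hm | hm
  · have : Subsingleton G := ⟨fun a b => Subtype.ext (Units.ext (Subsingleton.elim _ _))⟩
    refine ⟨1, ?_, 1, G.one_mem, Subsingleton.elim _ _⟩
    rw [Nat.card_of_subsingleton (1 : G)]
    exact IsPrimitiveRoot.one
  · obtain ⟨g, hg⟩ := IsCyclic.exists_generator (α := G)
    obtain ⟨c, hc⟩ := hscalar g g.2
    refine ⟨c, ?_, g, g.2, hc⟩
    have hscal : Function.Injective (algebraMap K (Matrix (Fin m) (Fin m) K)) :=
      (algebraMap K _).injective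
    rw [← orderOf_eq_card_of_forall_mem_zpowers hg, ← Subgroup.orderOf_coe, ← orderOf_units, hc,
      ← Algebra.algebraMap_eq_smul_one]
    exact orderOf_injective (algebraMap K (Matrix (Fin m) (Fin m) K)).toMonoidHom hscal c ▸
      IsPrimitiveRoot.orderOf c

/-- The invariants of a cyclic group of scalar matrices of order `d` are spanned by the words
whose length is divisible by `d`. -/
theorem toSubmodule_freeInvariants_eq_span [Field K] (G : Subgroup (GL (Fin m) K)) [IsCyclic G]
    (hscalar : ∀ g : GL (Fin m) K, g ∈ G → ∃ c : K,
      (g : Matrix (Fin m) (Fin m) K) = c • (1 : Matrix (Fin m) (Fin m) K)) :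
    Subalgebra.toSubmodule (freeInvariants K G) =
      Submodule.span K (FreeMonoid.lift (ι K) '' {w | Nat.card G ∣ w.length}) := by
  apply le_antisymm
  · intro x hx
    obtain ⟨c, hprim, g, hg, hgc⟩ := exists_isPrimitiveRoot_of_scalar G hscalar
    have hinv := mem_freeInvariants.mp hx g hg
    rw [hgc] at hinv
    rw [← (basisFreeMonoid K (Fin m)).linearCombination_repr x]
    refine Submodule.sum_mem _ fun w hw =>
      Submodule.smul_mem _ _ (Submodule.subset_span ⟨w, ?_, ?_⟩)
    · have hcoeff := repr_freeAct_smul_one c x w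
      rw [hinv] at hcoeff
      exact hprim.dvd_of_pow_eq_one _
        (mul_eq_right₀ (Finsupp.mem_support_iff.mp hw) |>.mp hcoeff.symm)
    · exact (basisFreeMonoid_apply w).symm
  · rw [Submodule.span_le]
    rintro _ ⟨w, ⟨k, hk⟩, rfl⟩
    refine mem_freeInvariants.mpr fun g hg => ?_
    obtain ⟨c, hc⟩ := hscalar g hg
    have hpow : (c ^ Nat.card G) • (1 : Matrix (Fin m) (Fin m) K) = 1 := by
      have h : g ^ Nat.card G = 1 := congrArg Subtype.val (pow_card_eq_one' (x := (⟨g, hg⟩ : G)))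
      have h' := congrArg Units.val h
      rwa [Units.val_pow_eq_pow_val, hc, smul_pow, one_pow] at h'
    rcases isEmpty_or_nonempty (Fin m) with hm | ⟨⟨i⟩⟩
    · rw [Subsingleton.elim w 1, map_one, map_one]
    · have hc1 : c ^ Nat.card G = 1 := by simpa using congrFun (congrFun hpow i) i
      rw [hc, freeAct_smul_one_word, hk, pow_mul, hc1, one_pow, one_smul]

end ScalarAction

/-- If `G ≤ GL_m(K)` is a finite cyclic group of order `d` consisting of scalar matrices, then
`K⟨x_1,…,x_m⟩^G` is spanned by the monomials of total degree divisible by `d` and is isomorphic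
to the free associative algebra of rank `m ^ d`. -/
theorem freeInvariants_of_scalar_action {K : Type*} [Field K] [IsAlgClosed K] [CharZero K]
    {m d : ℕ} (G : Subgroup (GL (Fin m) K)) [Fintype G] (hcyc : IsCyclic G)
    (hcard : Fintype.card G = d)
    (hscalar : ∀ g : GL (Fin m) K, g ∈ G → ∃ c : K,
      (g : Matrix (Fin m) (Fin m) K) = c • (1 : Matrix (Fin m) (Fin m) K)) :
    Subalgebra.toSubmodule (freeInvariants K G) =
      Submodule.span K
        {x | ∃ l : List (Fin m), d ∣ l.length ∧ x = (l.map (FreeAlgebra.ι K)).prod} ∧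
    Nonempty ((freeInvariants K G) ≃ₐ[K] FreeAlgebra K (Fin (m ^ d))) := by
  subst hcard
  rw [← Nat.card_eq_fintype_card]
  have hspan := toSubmodule_freeInvariants_eq_span G hscalar
  refine ⟨hspan.trans (congrArg _ ?_), ?_⟩
  · ext x
    constructor
    · rintro ⟨w, hw, rfl⟩
      exact ⟨w.toList, hw, FreeMonoid.lift_apply _ w⟩
    · rintro ⟨l, hl, rfl⟩
      exact ⟨FreeMonoid.ofList l, hl, FreeMonoid.lift_ofList _ l⟩
  · let code (y : Fin (m ^ Nat.card G)) : FreeMonoid (Fin m) :=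
      FreeMonoid.ofList (List.ofFn (finFunctionFinEquiv.symm y))
    have hinj : Function.Injective code :=
      FreeMonoid.ofList.injective.comp (List.ofFn_injective.comp finFunctionFinEquiv.symm.injective)
    have hlen (y) : (code y).length = Nat.card G := List.length_ofFn
    have hrange : Set.range code = {w | w.length = Nat.card G} := by
      refine Set.Subset.antisymm (Set.range_subset_iff.mpr hlen) fun w hw => ?_
      have hw' : w.toList.length = Nat.card G := hw
      refine ⟨finFunctionFinEquiv fun i => w.toList.get (i.cast hw'.symm), ?_⟩
      apply FreeMonoid.toList.injective
      refine List.ext_get (by simp [code, hw']) ?_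
      simp [code]
    have hfree : (FreeAlgebra.lift K fun y => FreeMonoid.lift (FreeAlgebra.ι K) (code y)).range =
        freeInvariants K G := by
      apply Subalgebra.toSubmodule_injective
      rw [FreeAlgebra.toSubmodule_range_lift_word, FreeMonoid.range_lift_eq_of_range_eq hrange,
        hspan]
    exact ⟨((AlgEquiv.ofInjective _ (FreeAlgebra.lift_injective_of_freeMonoidLift_injective
      (FreeMonoid.lift_injective_of_length_eq Nat.card_pos hinj hlen))).trans
        (Subalgebra.equivOfEq _ _ hfree)).symm⟩
end

section
/- (Molien-type formula for quotients) Let I be a multihomogeneous ideal of K⟨x_1,…,x_m⟩ that is stable under the action of GL_m(K), let F = K⟨x_1,…,x_m⟩/I with its induced multigrading, let G be a finite subgroup of GL_m(K), and for g ∈ G let ξ_1(g),…,ξ_m(g) be the eigenvalues of g. Then Hilb(F^G, t) = (1/|G|) Σ_{g∈G} Hilb(F, ξ_1(g)t, …, ξ_m(g)t), as an identity of formal power series in t over K. -/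
open Matrix

/-- The homogeneous component of total degree `n` of the free associative algebra: the span
of all monomials (words) of length `n` in the free generators. -/
noncomputable def freeDeg (K : Type*) [CommSemiring K] (m : ℕ) (n : ℕ) :
    Submodule K (FreeAlgebra K (Fin m)) :=
  Submodule.span K
    {x | ∃ l : List (Fin m), l.length = n ∧ x = (l.map (FreeAlgebra.ι K)).prod}

/-- The multihomogeneous component of multidegree `ν` of the free associative algebra: the span
of all monomials in which the variable `x i` occurs exactly `ν i` times. -/
noncomputable def freeMultiDeg (K : Type*) [CommSemiring K] {m : ℕ} (ν : Fin m → ℕ) :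
    Submodule K (FreeAlgebra K (Fin m)) :=
  Submodule.span K
    {x | ∃ l : List (Fin m), (∀ i, l.count i = ν i) ∧ x = (l.map (FreeAlgebra.ι K)).prod}

/-- Two families over the same finite index type with equal products `∏ (X - C (d i))` differ by
a permutation of the indices. -/
theorem exists_perm_comp_eq_of_prod_X_sub_C_eq {K ι : Type*} [Field K] [Fintype ι]
    {d ξ : ι → K}
    (h : ∏ i, (Polynomial.X - Polynomial.C (d i)) = ∏ i, (Polynomial.X - Polynomial.C (ξ i))) :
    ∃ σ : Equiv.Perm ι, ∀ i, d (σ i) = ξ i := by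
  classical
  have hroots : ∀ f : ι → K, (∏ i, (Polynomial.X - Polynomial.C (f i))).roots =
      Finset.univ.val.map f := by
    intro f
    rw [← Polynomial.roots_multiset_prod_X_sub_C (Finset.univ.val.map f), Multiset.map_map]
    rfl
  have hmap : Finset.univ.val.map ξ = Finset.univ.val.map d := by
    rw [← hroots, ← hroots, h]
  have hcard : ∀ c, Fintype.card {i // ξ i = c} = Fintype.card {i // d i = c} := by
    intro c
    have hc := congrArg (Multiset.count c) hmap
    rw [Multiset.count_map, Multiset.count_map] at hc
    rw [Fintype.card_subtype, Fintype.card_subtype]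
    simpa [Finset.card_def, Finset.filter_val, eq_comm] using hc
  exact ⟨Equiv.ofFiberEquiv fun c => Fintype.equivOfCardEq (hcard c),
    fun i => Equiv.ofFiberEquiv_map _ i⟩

/-- A semisimple endomorphism over an algebraically closed field has a basis of eigenvectors. -/
theorem Module.End.IsSemisimple.exists_eigenbasis {K V : Type*} [Field K] [IsAlgClosed K]
    [AddCommGroup V] [Module K V] [FiniteDimensional K V] {f : Module.End K V}
    (hf : f.IsSemisimple) {n : ℕ} (hn : Module.finrank K V = n) :
    ∃ (b : Module.Basis (Fin n) K V) (d : Fin n → K), ∀ i, f (b i) = d i • b i := by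
  have hs : ⊤ ≤ Submodule.span K {v : V | ∃ μ : K, f v = μ • v} := by
    rw [← hf.iSup_eigenspace_eq_top]
    exact iSup_le fun μ v hv =>
      Submodule.subset_span ⟨μ, Module.End.mem_eigenspace_iff.mp hv⟩
  have : Fintype ((linearIndepOn_empty K id).extend
      (Set.empty_subset {v : V | ∃ μ : K, f v = μ • v})) :=
    FiniteDimensional.fintypeBasisIndex (Module.Basis.ofSpan hs)
  let e := Fintype.equivFinOfCardEq
    ((Module.finrank_eq_card_basis (Module.Basis.ofSpan hs)).symm.trans hn)
  have hb : ∀ i, ∃ μ : K, f ((Module.Basis.ofSpan hs).reindex e i) =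
      μ • (Module.Basis.ofSpan hs).reindex e i := by
    intro i
    rw [Module.Basis.reindex_apply]
    exact Module.Basis.ofSpan_subset hs (Set.mem_range_self _)
  choose d hd using hb
  exact ⟨_, d, hd⟩

/-- An invertible matrix of finite order over an algebraically closed field of characteristic
zero is conjugate to the diagonal matrix of its eigenvalues, listed in any given order. -/
theorem Matrix.GeneralLinearGroup.exists_conj_eq_diagonal {K : Type*} [Field K] [IsAlgClosed K]
    [CharZero K] {m : ℕ} {g : GL (Fin m) K} (hg : IsOfFinOrder g) {ξ : Fin m → K}
    (hξ : (g : Matrix (Fin m) (Fin m) K).charpoly =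
      ∏ i, (Polynomial.X - Polynomial.C (ξ i))) :
    ∃ P D : GL (Fin m) K, g = P * D * P⁻¹ ∧
      (D : Matrix (Fin m) (Fin m) K) = Matrix.diagonal ξ := by
  obtain ⟨N, hN, hgN⟩ := hg.exists_pow_eq_one
  set f : Module.End K (Fin m → K) := Matrix.toLinAlgEquiv' (g : Matrix (Fin m) (Fin m) K)
    with hfdef
  have hfN : f ^ N = 1 := by
    rw [hfdef, ← map_pow, ← Units.val_pow_eq_pow_val, hgN, Units.val_one, map_one]
  have hss : f.IsSemisimple := by
    have hsep : (Polynomial.X ^ N - Polynomial.C (1 : K)).Separable :=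
      Polynomial.separable_X_pow_sub_C 1 (Nat.cast_ne_zero.mpr hN.ne') one_ne_zero
    refine Module.End.isSemisimple_of_squarefree_aeval_eq_zero hsep.squarefree ?_
    simp [hfN]
  obtain ⟨b, d, hbd⟩ := hss.exists_eigenbasis (Module.finrank_fin_fun K)
  have hf_diag : LinearMap.toMatrix b b f = Matrix.diagonal d := by
    ext i j
    rw [LinearMap.toMatrix_apply, hbd, map_smul, Finsupp.smul_apply, Module.Basis.repr_self,
      Finsupp.single_apply, Matrix.diagonal_apply]
    by_cases h : i = j <;> simp [h, eq_comm]
  have hchar : f.charpoly = (g : Matrix (Fin m) (Fin m) K).charpoly := by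
    rw [hfdef]
    exact Matrix.charpoly_toLin' _
  obtain ⟨σ, hσ⟩ := exists_perm_comp_eq_of_prod_X_sub_C_eq (d := d) (ξ := ξ) (by
    rw [← hξ, ← hchar, ← LinearMap.charpoly_toMatrix f b, hf_diag, Matrix.charpoly_diagonal])
  set c := b.reindex σ.symm with hc
  have hcξ : ∀ i, f (c i) = ξ i • c i := by
    intro i
    simp [hc, hbd, hσ]
  set P : GL (Fin m) K :=
    ⟨(Pi.basisFun K (Fin m)).toMatrix c, c.toMatrix (Pi.basisFun K (Fin m)),
      Module.Basis.toMatrix_mul_toMatrix_flip _ _, Module.Basis.toMatrix_mul_toMatrix_flip _ _⟩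
    with hP
  refine ⟨P, P⁻¹ * g * P, by group, ?_⟩
  suffices h : (g : Matrix (Fin m) (Fin m) K) * P = P * Matrix.diagonal ξ by
    rw [mul_assoc, Units.val_mul, Units.val_mul, h, ← mul_assoc, ← Units.val_mul,
      inv_mul_cancel, Units.val_one, one_mul]
  ext i j
  have h1 := congrFun (hcξ j) i
  rw [Matrix.mul_diagonal]
  simpa [hfdef, hP, Matrix.mul_apply, Matrix.mulVec, dotProduct, Module.Basis.toMatrix_apply,
    mul_comm] using h1

section FreeAlgebra

variable {K : Type*} {m : ℕ}

section CommSemiring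

variable [CommSemiring K]

theorem FreeAlgebra.basisFreeMonoid_apply_s10 {X : Type*} (l : FreeMonoid X) :
    FreeAlgebra.basisFreeMonoid K X l = (l.toList.map (FreeAlgebra.ι K)).prod := by
  simp [FreeAlgebra.basisFreeMonoid, FreeAlgebra.equivMonoidAlgebraFreeMonoid,
    MonoidAlgebra.lift_single, FreeMonoid.lift_apply]

theorem freeAct_ι (g : Matrix (Fin m) (Fin m) K) (j : Fin m) :
    freeAct K g (FreeAlgebra.ι K j) = ∑ i, g i j • FreeAlgebra.ι K i :=
  FreeAlgebra.lift_ι_apply _ _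

theorem freeAct_one : freeAct K (1 : Matrix (Fin m) (Fin m) K) = AlgHom.id K _ := by
  ext j
  simp [freeAct_ι, Matrix.one_apply]

theorem freeAct_mul (g h : Matrix (Fin m) (Fin m) K) :
    freeAct K (g * h) = (freeAct K g).comp (freeAct K h) := by
  ext j
  simp only [Function.comp_apply, AlgHom.coe_comp, freeAct_ι, map_sum, map_smul,
    Finset.smul_sum, Matrix.mul_apply, Finset.sum_smul, smul_smul]
  rw [Finset.sum_comm]
  simp only [mul_comm]

theorem mul_mem_freeDeg {a b : ℕ} {x y : FreeAlgebra K (Fin m)} (hx : x ∈ freeDeg K m a)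
    (hy : y ∈ freeDeg K m b) : x * y ∈ freeDeg K m (a + b) := by
  have h := Submodule.mul_mem_mul hx hy
  rw [freeDeg, freeDeg, Submodule.span_mul_span] at h
  refine Submodule.span_mono ?_ h
  rintro _ ⟨_, ⟨l, rfl, rfl⟩, _, ⟨l', rfl, rfl⟩, rfl⟩
  exact ⟨l ++ l', by simp, by simp⟩

theorem freeAct_mem_freeDeg (g : Matrix (Fin m) (Fin m) K) {n : ℕ} {x : FreeAlgebra K (Fin m)}
    (hx : x ∈ freeDeg K m n) : freeAct K g x ∈ freeDeg K m n := by
  suffices h : freeDeg K m n ≤ (freeDeg K m n).comap (freeAct K g).toLinearMap from h hx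
  refine Submodule.span_le.mpr ?_
  rintro _ ⟨l, rfl, rfl⟩
  rw [SetLike.mem_coe, Submodule.mem_comap, AlgHom.toLinearMap_apply]
  clear hx
  induction l with
  | nil => exact Submodule.subset_span ⟨[], rfl, by simp⟩
  | cons j l ih =>
    rw [List.map_cons, List.prod_cons, map_mul, freeAct_ι, List.length_cons, add_comm]
    refine mul_mem_freeDeg (Submodule.sum_mem _ fun i _ => Submodule.smul_mem _ _ ?_) ih
    exact Submodule.subset_span ⟨[i], rfl, by simp⟩

theorem List.sum_count_eq_length_of_fin (l : List (Fin m)) : ∑ i, l.count i = l.length := by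
  simpa using Multiset.sum_count_eq_card (s := Finset.univ) (m := (l : Multiset (Fin m)))
    (fun i _ => Finset.mem_univ i)

theorem freeMultiDeg_le_freeDeg (ν : Fin m → ℕ) :
    freeMultiDeg K ν ≤ freeDeg K m (∑ i, ν i) := by
  refine Submodule.span_mono ?_
  rintro _ ⟨l, hl, rfl⟩
  exact ⟨l, by simp [← hl, List.sum_count_eq_length_of_fin], rfl⟩

theorem freeAct_diagonal_prod_map_ι (ξ : Fin m → K) (l : List (Fin m)) :
    freeAct K (Matrix.diagonal ξ) (l.map (FreeAlgebra.ι K)).prod =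
      (∏ i, ξ i ^ l.count i) • (l.map (FreeAlgebra.ι K)).prod := by
  induction l with
  | nil => simp
  | cons j l ih =>
    have hj : freeAct K (Matrix.diagonal ξ) (FreeAlgebra.ι K j) = ξ j • FreeAlgebra.ι K j := by
      rw [freeAct_ι, Finset.sum_eq_single j] <;> simp +contextual
    have hprod : ∏ i, ξ i ^ (j :: l).count i = ξ j * ∏ i, ξ i ^ l.count i := by
      simp only [List.count_cons, pow_add, Finset.prod_mul_distrib, mul_comm (ξ j)]
      simp
    rw [List.map_cons, List.prod_cons, map_mul, hj, ih, smul_mul_smul_comm, hprod]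

/-- The projection of the free associative algebra onto its component of multidegree `ν`. -/
noncomputable def freeProj (ν : Fin m → ℕ) :
    FreeAlgebra K (Fin m) →ₗ[K] FreeAlgebra K (Fin m) :=
  (FreeAlgebra.basisFreeMonoid K (Fin m)).constr K fun l =>
    if ∀ i, l.toList.count i = ν i then (l.toList.map (FreeAlgebra.ι K)).prod else 0

theorem freeProj_prod_map_ι (ν : Fin m → ℕ) (l : List (Fin m)) :
    freeProj ν (l.map (FreeAlgebra.ι K)).prod =
      if ∀ i, l.count i = ν i then (l.map (FreeAlgebra.ι K)).prod else 0 := by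
  have h := FreeAlgebra.basisFreeMonoid_apply_s10 (K := K) (FreeMonoid.ofList l)
  rw [FreeMonoid.toList_ofList] at h
  conv_lhs => rw [← h]
  rw [freeProj, Module.Basis.constr_basis]
  rfl

theorem freeProj_mem (ν : Fin m → ℕ) (x : FreeAlgebra K (Fin m)) :
    freeProj ν x ∈ freeMultiDeg K ν := by
  suffices h : ⊤ ≤ (freeMultiDeg K ν).comap (freeProj ν) from h Submodule.mem_top
  rw [← (FreeAlgebra.basisFreeMonoid K (Fin m)).span_eq, Submodule.span_le]
  rintro _ ⟨l, rfl⟩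
  rw [FreeAlgebra.basisFreeMonoid_apply_s10, SetLike.mem_coe, Submodule.mem_comap,
    freeProj_prod_map_ι]
  split_ifs with hl
  · exact Submodule.subset_span ⟨_, hl, rfl⟩
  · exact zero_mem _

theorem freeProj_mem_freeDeg (ν : Fin m → ℕ) {n : ℕ} {x : FreeAlgebra K (Fin m)}
    (hx : x ∈ freeDeg K m n) : freeProj ν x ∈ freeDeg K m n := by
  suffices h : freeDeg K m n ≤ (freeDeg K m n).comap (freeProj ν) from h hx
  refine Submodule.span_le.mpr ?_
  rintro _ ⟨l, hl, rfl⟩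
  rw [SetLike.mem_coe, Submodule.mem_comap, freeProj_prod_map_ι]
  split_ifs
  · exact Submodule.subset_span ⟨l, hl, rfl⟩
  · exact zero_mem _

theorem freeProj_of_mem {ν : Fin m → ℕ} {x : FreeAlgebra K (Fin m)}
    (hx : x ∈ freeMultiDeg K ν) : freeProj ν x = x := by
  induction hx using Submodule.span_induction with
  | mem x hx =>
    obtain ⟨l, hl, rfl⟩ := hx
    rw [freeProj_prod_map_ι, if_pos hl]
  | zero => simp
  | add x y _ _ hx hy => rw [map_add, hx, hy]
  | smul c x _ hx => rw [map_smul, hx]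

theorem freeProj_of_mem_of_ne {μ ν : Fin m → ℕ} (hne : μ ≠ ν) {x : FreeAlgebra K (Fin m)}
    (hx : x ∈ freeMultiDeg K μ) : freeProj ν x = 0 := by
  induction hx using Submodule.span_induction with
  | mem x hx =>
    obtain ⟨l, hl, rfl⟩ := hx
    rw [freeProj_prod_map_ι, if_neg fun h => hne (funext fun i => (hl i).symm.trans (h i))]
  | zero => simp
  | add x y _ _ hx hy => rw [map_add, hx, hy, add_zero]
  | smul c x _ hx => rw [map_smul, hx, smul_zero]

theorem freeProj_mem_of_multihomogeneous {I : Submodule K (FreeAlgebra K (Fin m))}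
    (hmulti : I = ⨆ ν : Fin m → ℕ, I ⊓ freeMultiDeg K ν) (ν : Fin m → ℕ) :
    I ≤ I.comap (freeProj ν) := by
  conv_lhs => rw [hmulti]
  refine iSup_le fun μ x hx => ?_
  rw [Submodule.mem_comap]
  by_cases h : μ = ν
  · subst h
    rw [freeProj_of_mem hx.2]
    exact hx.1
  · rw [freeProj_of_mem_of_ne h hx.2]
    exact zero_mem I

theorem freeAct_diagonal_eq_sum_freeProj (ξ : Fin m → K) {n : ℕ} {x : FreeAlgebra K (Fin m)}
    (hx : x ∈ freeDeg K m n) :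
    freeAct K (Matrix.diagonal ξ) x =
      ∑ ν ∈ Finset.Nat.antidiagonalTuple m n, (∏ i, ξ i ^ ν i) • freeProj ν x := by
  induction hx using Submodule.span_induction with
  | mem x hx =>
    obtain ⟨l, hl, rfl⟩ := hx
    rw [freeAct_diagonal_prod_map_ι, Finset.sum_eq_single fun i => l.count i]
    · simp [freeProj_prod_map_ι]
    · intro ν _ hν
      rw [freeProj_prod_map_ι, if_neg fun h => hν (funext fun i => (h i).symm), smul_zero]
    · intro h
      exact absurd (Finset.Nat.mem_antidiagonalTuple.mpr
        ((List.sum_count_eq_length_of_fin l).trans hl)) h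
  | zero => simp
  | add x y _ _ hx hy => simp only [map_add, hx, hy, smul_add, Finset.sum_add_distrib]
  | smul c x _ hx => simp only [map_smul, hx, Finset.smul_sum, smul_comm c]

end CommSemiring

section Field

variable [Field K]

instance finiteDimensional_freeDeg (n : ℕ) : FiniteDimensional K (freeDeg K m n) := by
  refine FiniteDimensional.span_of_finite K ?_
  refine ((List.finite_length_eq (Fin m) n).image
    fun l => (l.map (FreeAlgebra.ι K)).prod).subset ?_
  rintro _ ⟨l, hl, rfl⟩
  exact ⟨l, hl, rfl⟩

/-- The representation of `GL_m(K)` on the degree `n` component of the quotient of the free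
associative algebra by a `GL_m(K)`-stable subspace. -/
noncomputable def quotientDegRep (I : Submodule K (FreeAlgebra K (Fin m)))
    (hstable : ∀ g : GL (Fin m) K, ∀ x ∈ I,
      freeAct K (g : Matrix (Fin m) (Fin m) K) x ∈ I) (n : ℕ) :
    Representation K (GL (Fin m) K) ((freeDeg K m n).map I.mkQ) where
  toFun g := (I.mapQ I (freeAct K (g : Matrix (Fin m) (Fin m) K)).toLinearMap
    (hstable g)).restrict (by
      rintro _ ⟨x, hx, rfl⟩
      exact ⟨_, freeAct_mem_freeDeg _ hx, rfl⟩)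
  map_one' := by
    ext ⟨_, x, hx, rfl⟩
    simp [freeAct_one]
  map_mul' g h := by
    ext ⟨_, x, hx, rfl⟩
    refine congrArg I.mkQ (?_ : freeAct K _ x = freeAct K _ (freeAct K _ x))
    rw [Units.val_mul, freeAct_mul, AlgHom.comp_apply]

theorem coe_quotientDegRep_mk (I : Submodule K (FreeAlgebra K (Fin m)))
    (hstable : ∀ g : GL (Fin m) K, ∀ x ∈ I,
      freeAct K (g : Matrix (Fin m) (Fin m) K) x ∈ I) {n : ℕ} (g : GL (Fin m) K)
    {x : FreeAlgebra K (Fin m)} (hx : I.mkQ x ∈ (freeDeg K m n).map I.mkQ) :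
    (quotientDegRep I hstable n g ⟨I.mkQ x, hx⟩ : FreeAlgebra K (Fin m) ⧸ I) =
      I.mkQ (freeAct K (g : Matrix (Fin m) (Fin m) K) x) :=
  rfl

/-- If `f` is a combination of projections onto subspaces `N i`, its trace is the same
combination of their dimensions. -/
theorem LinearMap.trace_eq_sum_mul_finrank_of_isProj {ι V : Type*} [AddCommGroup V] [Module K V]
    [FiniteDimensional K V] {s : Finset ι} {N : ι → Submodule K V} {p : ι → V →ₗ[K] V}
    (hp : ∀ i ∈ s, LinearMap.IsProj (N i) (p i)) {c : ι → K} {f : V →ₗ[K] V}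
    (hf : f = ∑ i ∈ s, c i • p i) :
    LinearMap.trace K V f = ∑ i ∈ s, (Module.finrank K (N i) : K) * c i := by
  rw [hf, map_sum]
  refine Finset.sum_congr rfl fun i hi => ?_
  rw [map_smul, (hp i hi).trace, smul_eq_mul, mul_comm]

theorem character_quotientDegRep_of_diagonal {I : Submodule K (FreeAlgebra K (Fin m))}
    (hmulti : I = ⨆ ν : Fin m → ℕ, I ⊓ freeMultiDeg K ν)
    (hstable : ∀ g : GL (Fin m) K, ∀ x ∈ I,
      freeAct K (g : Matrix (Fin m) (Fin m) K) x ∈ I) (n : ℕ) {D : GL (Fin m) K}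
    {ξ : Fin m → K} (hD : (D : Matrix (Fin m) (Fin m) K) = Matrix.diagonal ξ) :
    (quotientDegRep I hstable n).character D =
      ∑ ν ∈ Finset.Nat.antidiagonalTuple m n,
        (Module.finrank K ((freeMultiDeg K ν).map I.mkQ) : K) * ∏ i, ξ i ^ ν i := by
  set W := (freeDeg K m n).map I.mkQ with hW
  let π (ν : Fin m → ℕ) := I.mapQ I (freeProj ν) (freeProj_mem_of_multihomogeneous hmulti ν)
  have hle : ∀ ν ∈ Finset.Nat.antidiagonalTuple m n, (freeMultiDeg K ν).map I.mkQ ≤ W := by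
    intro ν hν
    rw [← Finset.Nat.mem_antidiagonalTuple.mp hν] at hW
    exact hW ▸ Submodule.map_mono (freeMultiDeg_le_freeDeg ν)
  have hπ : ∀ ν x, π ν x ∈ (freeMultiDeg K ν).map I.mkQ := by
    intro ν x
    obtain ⟨x, rfl⟩ := I.mkQ_surjective x
    exact ⟨_, freeProj_mem ν x, rfl⟩
  have hπW : ∀ ν, ∀ x ∈ W, π ν x ∈ W := by
    rintro ν _ ⟨x, hx, rfl⟩
    exact ⟨_, freeProj_mem_freeDeg ν hx, rfl⟩
  have hproj : ∀ ν ∈ Finset.Nat.antidiagonalTuple m n,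
      LinearMap.IsProj (((freeMultiDeg K ν).map I.mkQ).comap W.subtype)
        ((π ν).restrict (hπW ν)) := by
    intro ν hν
    refine ⟨fun x => hπ ν x, ?_⟩
    rintro ⟨_, hxW⟩ ⟨x, hx, rfl⟩
    refine Subtype.ext ?_
    exact congrArg I.mkQ (freeProj_of_mem hx)
  rw [Representation.character, LinearMap.trace_eq_sum_mul_finrank_of_isProj hproj
    (c := fun ν => ∏ i, ξ i ^ ν i)]
  · refine Finset.sum_congr rfl fun ν hν => ?_
    rw [(Submodule.comapSubtypeEquivOfLe (hle ν hν)).finrank_eq]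
  · ext ⟨y, hy⟩
    obtain ⟨x, hx, rfl⟩ := Submodule.mem_map.mp hy
    rw [coe_quotientDegRep_mk, hD, freeAct_diagonal_eq_sum_freeProj ξ hx]
    simp [π, LinearMap.sum_apply]

end Field

end FreeAlgebra

/-- **Molien-type formula for relatively free algebras (Formanek).** Let `I` be a
multihomogeneous `GL_m(K)`-stable two-sided ideal of `K⟨x_1,…,x_m⟩`, let `F` be the quotient
(as a graded vector space, `F = K⟨x_1,…,x_m⟩ ⧸ I`), let `G ≤ GL_m(K)` be finite, let
`ξ g 1, …, ξ g m` be the eigenvalues of `g ∈ G`, and let `ρ` be the induced action of `G`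
on `F`.  Then `Hilb(F^G, t) = (1/|G|) ∑_{g ∈ G} Hilb(F, ξ₁(g)t, …, ξ_m(g)t)`. -/
theorem molien_relatively_free {K : Type*} [Field K] [IsAlgClosed K] [CharZero K] {m : ℕ}
    (I : Submodule K (FreeAlgebra K (Fin m)))
    -- `I` is a two-sided ideal
    (hideal : ∀ a b x : FreeAlgebra K (Fin m), x ∈ I → a * x * b ∈ I)
    -- `I` is multihomogeneous
    (hmulti : I = ⨆ ν : Fin m → ℕ, I ⊓ freeMultiDeg K ν)
    -- `I` is stable under the action of `GL_m(K)`
    (hstable : ∀ g : GL (Fin m) K, ∀ x ∈ I,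
      freeAct K (g : Matrix (Fin m) (Fin m) K) x ∈ I)
    (G : Subgroup (GL (Fin m) K)) [Fintype G]
    -- `ξ g` enumerates the eigenvalues of `g`, i.e. the roots of its characteristic polynomial
    (ξ : GL (Fin m) K → Fin m → K)
    (hξ : ∀ g ∈ G, ((g : GL (Fin m) K) : Matrix (Fin m) (Fin m) K).charpoly =
      ∏ i, (Polynomial.X - Polynomial.C (ξ g i)))
    -- `ρ` is the action of `G` induced on the quotient `F = K⟨x_1,…,x_m⟩ ⧸ I`
    (ρ : GL (Fin m) K → (FreeAlgebra K (Fin m) ⧸ I) →ₗ[K] (FreeAlgebra K (Fin m) ⧸ I))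
    (hρ : ∀ g ∈ G, ∀ a : FreeAlgebra K (Fin m),
      ρ g (Submodule.Quotient.mk a) =
        Submodule.Quotient.mk (freeAct K (g : Matrix (Fin m) (Fin m) K) a)) :
    (PowerSeries.mk fun n => (Module.finrank K
        ↥((freeDeg K m n).map I.mkQ ⊓ ⨅ g ∈ G, LinearMap.ker (ρ g - LinearMap.id)) : K)) =
      (Fintype.card G : K)⁻¹ •
        ∑ g : G, PowerSeries.mk fun n =>
          ∑ ν ∈ Finset.Nat.antidiagonalTuple m n,
            (Module.finrank K ((freeMultiDeg K ν).map I.mkQ) : K) *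
              ∏ i, ξ (g : GL (Fin m) K) i ^ ν i := by
  ext n
  have : Invertible (Nat.card G : K) :=
    invertibleOfNonzero (Nat.cast_ne_zero.mpr Nat.card_pos.ne')
  let R : Representation K G ((freeDeg K m n).map I.mkQ) :=
    (quotientDegRep I hstable n).comp G.subtype
  have hchar : ∀ g : G, R.character g = ∑ ν ∈ Finset.Nat.antidiagonalTuple m n,
      (Module.finrank K ((freeMultiDeg K ν).map I.mkQ) : K) *
        ∏ i, ξ (g : GL (Fin m) K) i ^ ν i := by
    intro g
    obtain ⟨P, D, hPD, hD⟩ := Matrix.GeneralLinearGroup.exists_conj_eq_diagonal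
      (G.subtype.isOfFinOrder (isOfFinOrder_of_finite g)) (hξ g g.2)
    rw [← character_quotientDegRep_of_diagonal hmulti hstable n hD,
      ← Representation.char_conj (quotientDegRep I hstable n) D P, ← hPD]
    rfl
  have hinv : R.invariants.map ((freeDeg K m n).map I.mkQ).subtype =
      (freeDeg K m n).map I.mkQ ⊓ ⨅ g ∈ G, LinearMap.ker (ρ g - LinearMap.id) := by
    have hRρ : ∀ (g : G) (x : (freeDeg K m n).map I.mkQ),
        (R g x : FreeAlgebra K (Fin m) ⧸ I) = ρ g x := by
      rintro g ⟨_, x, hx, rfl⟩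
      exact (hρ g g.2 x).symm
    ext y
    simp only [Submodule.mem_map, Submodule.mem_inf, Submodule.mem_iInf, LinearMap.mem_ker,
      LinearMap.sub_apply, LinearMap.id_apply, sub_eq_zero, Representation.mem_invariants]
    constructor
    · rintro ⟨x, hx, rfl⟩
      exact ⟨x.2, fun g hg => (hRρ ⟨g, hg⟩ x).symm.trans (congrArg Subtype.val (hx ⟨g, hg⟩))⟩
    · rintro ⟨hy, hfix⟩
      exact ⟨⟨y, hy⟩, fun g => Subtype.ext ((hRρ g ⟨y, hy⟩).trans (hfix g g.2)), rfl⟩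
  rw [PowerSeries.coeff_mk, ← hinv, Submodule.finrank_map_subtype_eq,
    ← R.card_inv_mul_sum_char_eq_finrank, PowerSeries.coeff_smul, map_sum,
    Fintype.card_eq_nat_card]
  simp only [PowerSeries.coeff_mk, hchar, smul_eq_mul]
end
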